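/- arXiv:1609.07974 — 6 statements merged into one kernel-verified Lean document; each statement's English description precedes it below -/
import Mathlib

section
/- Let R be a ring, M an R-module and N a submodule of M. Define the socle series of a module X by Soc_0(X) = ⊥ and Soc_{κ+1}(X) = the preimage in X of the socle (the supremum of all simple submodules) of X ⧸ Soc_κ(X). Then for every natural number κ, the image of Soc_κ(N) under the inclusion N → M equals N ⊓ Soc_κ(M); in particular (κ = 1) the supremum of all simple submodules of M contained in N equals N ⊓ (supremum of all simple submodules of M). -/
/-- The socle of a module: the supremum of all simple submodules. -/
def socle (R M : Type*) [Ring R] [AddCommGroup M] [Module R M] : Submodule R M :=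
  sSup {S : Submodule R M | IsSimpleModule R S}

/-- The socle series: `Soc_0 = ⊥`, and `Soc_{κ+1} X` is the preimage in `X` of the socle of
`X ⧸ Soc_κ X`. -/
def socSeries (R M : Type*) [Ring R] [AddCommGroup M] [Module R M] : ℕ → Submodule R M
  | 0 => ⊥
  | k + 1 => (socle R (M ⧸ socSeries R M k)).comap (socSeries R M k).mkQ

section Socle

variable {R M M' : Type*} [Ring R] [AddCommGroup M] [Module R M] [AddCommGroup M'] [Module R M']

instance isSemisimpleModule_socle : IsSemisimpleModule R (socle R M) := by
  rw [socle, sSup_eq_iSup]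
  refine isSemisimpleModule_biSup_of_isSemisimpleModule_submodule fun S hS => ?_
  have : IsSimpleModule R S := hS
  infer_instance

theorem le_sSup_simples_le (P : Submodule R M) [IsSemisimpleModule R P] :
    P ≤ sSup {S : Submodule R M | IsSimpleModule R S ∧ S ≤ P} := by
  conv_lhs => rw [← Submodule.map_subtype_top P,
    ← IsSemisimpleModule.sSup_simples_eq_top R P]
  rw [Submodule.map_le_iff_le_comap]
  refine sSup_le fun S hS => Submodule.map_le_iff_le_comap.mp (le_sSup ⟨?_, ?_⟩)
  · have : IsSimpleModule R S := hS
    exact .congr (Submodule.equivMapOfInjective P.subtype P.subtype_injective S).symm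
  · exact Submodule.map_subtype_le P S

theorem le_socle_iff_isSemisimpleModule {P : Submodule R M} :
    P ≤ socle R M ↔ IsSemisimpleModule R P := by
  refine ⟨fun h => .of_injective (Submodule.inclusion h) (Submodule.inclusion_injective h),
    fun _ => ?_⟩
  exact (le_sSup_simples_le P).trans <| sSup_le_sSup fun S hS => hS.1

theorem comap_socle {f : M →ₗ[R] M'} (hf : Function.Injective f) :
    (socle R M').comap f = socle R M := by
  refine le_antisymm ?_ ?_
  · rw [le_socle_iff_isSemisimpleModule]
    exact .of_injective (f.submoduleComap (socle R M'))
      fun x y h => Subtype.ext (hf (congrArg Subtype.val h))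
  · rw [← Submodule.map_le_iff_le_comap, le_socle_iff_isSemisimpleModule]
    exact .congr (Submodule.equivMapOfInjective f hf (socle R M)).symm

theorem comap_socSeries {f : M →ₗ[R] M'} (hf : Function.Injective f) (k : ℕ) :
    (socSeries R M' k).comap f = socSeries R M k := by
  induction k with
  | zero => exact LinearMap.ker_eq_bot.mpr hf
  | succ k ih =>
    have hg : Function.Injective
        ((socSeries R M k).mapQ (socSeries R M' k) f ih.ge) := by
      rw [← LinearMap.ker_eq_bot, Submodule.ker_mapQ, ih, Submodule.mkQ_map_self]
    rw [socSeries, socSeries, ← comap_socle hg, ← Submodule.comap_comp, ← Submodule.comap_comp,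
      Submodule.mapQ_mkQ]

end Socle

/-- The socle series of a submodule `N ≤ M` is obtained by intersecting `N` with the socle
series of `M`; in particular the supremum of the simple submodules of `M` contained in `N`
is `N ⊓ socle M`. -/
theorem socSeries_of_submodule (R M : Type*) [Ring R] [AddCommGroup M] [Module R M]
    (N : Submodule R M) :
    (∀ κ : ℕ, Submodule.map N.subtype (socSeries R N κ) = N ⊓ socSeries R M κ) ∧
    sSup {S : Submodule R M | IsSimpleModule R S ∧ S ≤ N} =
      N ⊓ sSup {S : Submodule R M | IsSimpleModule R S} := by
  refine ⟨fun κ => ?_, le_antisymm ?_ ?_⟩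
  · rw [← comap_socSeries N.subtype_injective, Submodule.map_comap_subtype]
  · exact le_inf (sSup_le fun S hS => hS.2) (sSup_le_sSup fun S hS => hS.1)
  · have : IsSemisimpleModule R ↥(N ⊓ socle R M) :=
      le_socle_iff_isSemisimpleModule.mp inf_le_right
    exact (le_sSup_simples_le (N ⊓ socle R M)).trans <|
      sSup_le_sSup fun S hS => ⟨hS.1, hS.2.trans inf_le_left⟩
end

section
/- Let R be a ring with Jacobson radical J, M an R-module, N ≤ M a submodule, and κ a natural number. Let q : M ⧸ (N ⊓ (J^κ • ⊤)) → M ⧸ N be the canonical projection. Then q restricts to a bijection from the submodule J^κ • ⊤ of M ⧸ (N ⊓ (J^κ • ⊤)) onto the submodule J^κ • ⊤ of M ⧸ N; that is, rad^κ(M ⧸ (N ⊓ rad^κ M)) is carried isomorphically onto rad^κ(M ⧸ N). -/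
theorem Submodule.map_mkQ_smul_top {R M : Type*} [Ring R] [AddCommGroup M] [Module R M]
    (I : Ideal R) (P : Submodule R M) :
    (I • (⊤ : Submodule R M)).map P.mkQ = I • (⊤ : Submodule R (M ⧸ P)) := by
  rw [Submodule.map_smul'', Submodule.map_top, Submodule.range_mkQ]

/-- For submodules `N` and `S`, the projection `M ⧸ (N ⊓ S) → M ⧸ N` is a bijection from the image
of `S` onto the image of `S`. -/
theorem Submodule.bijOn_mapQ_inf {R M : Type*} [Ring R] [AddCommGroup M] [Module R M]
    (N S : Submodule R M) :
    Set.BijOn (Submodule.mapQ (N ⊓ S) N LinearMap.id (fun _ hx => hx.1))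
      (S.map (N ⊓ S).mkQ : Set (M ⧸ (N ⊓ S))) (S.map N.mkQ : Set (M ⧸ N)) := by
  refine ⟨?_, ?_, ?_⟩
  · rintro _ ⟨x, hx, rfl⟩
    exact ⟨x, hx, rfl⟩
  · rintro _ ⟨x, hx, rfl⟩ _ ⟨y, hy, rfl⟩ h
    exact (Submodule.Quotient.eq _).2 ⟨(Submodule.Quotient.eq N).1 h, S.sub_mem hx hy⟩
  · rintro _ ⟨x, hx, rfl⟩
    exact ⟨_, ⟨x, hx, rfl⟩, rfl⟩

/-- Let `J` be the Jacobson radical of `R`, `N ≤ M` and `κ : ℕ`. The canonical projection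
`q : M ⧸ (N ⊓ J^κ • ⊤) → M ⧸ N` restricts to a bijection from the submodule `J^κ • ⊤` of
`M ⧸ (N ⊓ J^κ • ⊤)` onto the submodule `J^κ • ⊤` of `M ⧸ N`:
`rad^κ (M ⧸ (N ⊓ rad^κ M))` is carried isomorphically onto `rad^κ (M ⧸ N)`. -/
theorem radical_pow_quotient_bijOn (R : Type*) [Ring R]
    {M : Type*} [AddCommGroup M] [Module R M] (N : Submodule R M) (κ : ℕ)
    (q : (M ⧸ (N ⊓ ((Ideal.jacobson (⊥ : Ideal R)) ^ κ • (⊤ : Submodule R M)))) →ₗ[R] M ⧸ N)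
    (hq : q = Submodule.mapQ (N ⊓ ((Ideal.jacobson (⊥ : Ideal R)) ^ κ • (⊤ : Submodule R M))) N
      LinearMap.id (fun x hx => hx.1)) :
    Set.BijOn q
      (((Ideal.jacobson (⊥ : Ideal R)) ^ κ •
        (⊤ : Submodule R (M ⧸ (N ⊓ ((Ideal.jacobson (⊥ : Ideal R)) ^ κ • (⊤ : Submodule R M))))) :
        Submodule R _) : Set _)
      (((Ideal.jacobson (⊥ : Ideal R)) ^ κ • (⊤ : Submodule R (M ⧸ N)) : Submodule R _) :
        Set _) := by
  subst hq
  rw [← Submodule.map_mkQ_smul_top, ← Submodule.map_mkQ_smul_top]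
  exact Submodule.bijOn_mapQ_inf N _
end

section
/- Let R be a ring with Jacobson radical J, C a simple R-module, and P an R-module with a surjective R-linear map ρ : P → C such that ker ρ ≤ J • ⊤. Then the map End_R(C) → Hom_R(P, C) given by γ ↦ γ ∘ ρ is a bijection. -/
/-- If `C` is a simple `R`-module and `ρ : P → C` is surjective with `ker ρ ≤ rad P = J • ⊤`
(the projective-cover situation), then `γ ↦ γ ∘ ρ` is a bijection
`End_R(C) ≃ Hom_R(P, C)`. -/
theorem endo_comp_bijective_of_projective_cover (R : Type*) [Ring R]
    {C P : Type*} [AddCommGroup C] [Module R C] [AddCommGroup P] [Module R P]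
    [IsSimpleModule R C]
    (ρ : P →ₗ[R] C) (hρ : Function.Surjective ρ)
    (hker : LinearMap.ker ρ ≤ (Ideal.jacobson (⊥ : Ideal R)) • (⊤ : Submodule R P)) :
    Function.Bijective (fun γ : C →ₗ[R] C => γ ∘ₗ ρ) := by
  rw [Ideal.jacobson_bot] at hker
  refine ⟨fun γ γ' h => (LinearMap.cancel_right hρ).mp h, fun f => ?_⟩
  have hf : LinearMap.ker ρ ≤ LinearMap.ker f :=
    (hker.trans (Ring.jacobson_smul_top_le R P)).trans (IsSemisimpleModule.jacobson_le_ker _ _ _ _ f)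
  refine ⟨(LinearMap.ker ρ).liftQ f hf ∘ₗ (ρ.quotKerEquivOfSurjective hρ).symm, ?_⟩
  ext p
  have hp : (ρ.quotKerEquivOfSurjective hρ).symm (ρ p) = Submodule.Quotient.mk p :=
    (LinearEquiv.symm_apply_eq _).mpr rfl
  simp [hp]
end

section
/- Let R be a ring with Jacobson radical J, let C and A be R-modules with A simple, let P be a projective R-module with a surjective R-linear map ρ : P → C, set K := ker ρ, and assume K ≤ J • ⊤ (so P → C is a projective-cover situation). Then there is an isomorphism of abelian groups Ext¹_R(C, A) ≅ Hom_R(K, A), where Ext¹ is the first Ext group in the abelian category of R-modules. -/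
universe u

open CategoryTheory CategoryTheory.Abelian

noncomputable instance hasDerCatModule (R : Type u) [Ring R] :
    HasDerivedCategory.{u+1} (ModuleCat.{u} R) :=
  HasDerivedCategory.standard _

instance hasExtModule (R : Type u) [Ring R] : HasExt.{u+1} (ModuleCat.{u} R) :=
  hasExt_of_hasDerivedCategory _

open Abelian.Ext in
/-- The connecting map `Hom(X₁, Y) → Ext¹(X₃, Y)` of a short exact sequence with projective middle
term `X₂` is an isomorphism if every morphism `X₂ ⟶ Y` restricts to zero on `X₁`. -/
noncomputable def CategoryTheory.ShortComplex.ShortExact.homAddEquivExtOne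
    {C : Type*} [Category* C] [Abelian C] [HasExt C] {S : ShortComplex C} (hS : S.ShortExact)
    [Projective S.X₂] (Y : C) (h : ∀ f : S.X₂ ⟶ Y, S.f ≫ f = 0) :
    (S.X₁ ⟶ Y) ≃+ Ext S.X₃ Y 1 :=
  addEquiv₀.symm.trans <| AddEquiv.ofBijective (hS.extClass.precomp Y (add_zero 1)) <| by
    refine ⟨(injective_iff_map_eq_zero _).2 fun x hx ↦ ?_, fun x ↦ ?_⟩
    · obtain ⟨y, rfl⟩ := contravariant_sequence_exact₁ hS Y x (add_zero 1) hx
      obtain ⟨f, rfl⟩ := addEquiv₀.symm.surjective y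
      simp [h f]
    · exact contravariant_sequence_exact₃ hS Y x (eq_zero_of_projective _) (add_zero 1)

/-- A linear map to a semisimple module vanishes on `J • ⊤`, where `J` is the Jacobson radical. -/
theorem IsSemisimpleModule.jacobson_bot_smul_top_le_ker {R M N : Type*} [Ring R]
    [AddCommGroup M] [Module R M] [AddCommGroup N] [Module R N] [IsSemisimpleModule R N]
    (f : M →ₗ[R] N) :
    (Ideal.jacobson (⊥ : Ideal R)) • (⊤ : Submodule R M) ≤ LinearMap.ker f := by
  rw [Ideal.jacobson_bot]
  exact (Ring.jacobson_smul_top_le R M).trans (IsSemisimpleModule.jacobson_le_ker _ _ _ _ f)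

/-- If `A` is simple, `P` is projective with a surjection `ρ : P → C` whose kernel `K`
is contained in `rad P = J • ⊤` (a projective-cover situation), then
`Ext¹_R(C, A) ≅ Hom_R(K, A)` as abelian groups, `K = ker ρ` playing the role of `ΩC`. -/
theorem ext_one_iso_hom_syzygy (R : Type u) [Ring R]
    (C A P : Type u) [AddCommGroup C] [Module R C] [AddCommGroup A] [Module R A]
    [AddCommGroup P] [Module R P]
    [IsSimpleModule R A] [Module.Projective R P]
    (ρ : P →ₗ[R] C) (hρ : Function.Surjective ρ)
    (hK : LinearMap.ker ρ ≤ (Ideal.jacobson (⊥ : Ideal R)) • (⊤ : Submodule R P)) :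
    Nonempty ((Ext (ModuleCat.of R C) (ModuleCat.of R A) 1) ≃+
      (↥(LinearMap.ker ρ) →ₗ[R] A)) := by
  have : Projective ρ.shortComplexKer.X₂ :=
    (IsProjective.iff_projective P).1 inferInstance
  exact ⟨((LinearMap.shortExact_shortComplexKer hρ).homAddEquivExtOne (ModuleCat.of R A)
    fun f ↦ ModuleCat.hom_ext <| LinearMap.ext fun x ↦
      IsSemisimpleModule.jacobson_bot_smul_top_le_ker f.hom (hK x.2)).symm.trans
    ModuleCat.homAddEquiv⟩
end

section
/- Let R be a ring, I an R-module that is injective (Module.Injective R I), A an R-module with an injective R-linear map ι : A → I whose image is essential in I (every nonzero submodule of I meets range ι nontrivially), A simple, and C a simple R-module. Then there is an isomorphism of abelian groups Ext¹_R(C, A) ≅ Hom_R(C, I ⧸ range ι). -/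
universe u

open CategoryTheory CategoryTheory.Abelian

namespace CategoryTheory.Abelian.Ext

universe w v t

variable {𝒜 : Type t} [Category.{v} 𝒜] [Abelian 𝒜] [HasExt.{w} 𝒜]

/-- Dimension shifting in degree one: if `0 ⟶ S.X₁ ⟶ S.X₂ ⟶ S.X₃ ⟶ 0` is short exact with
`S.X₂` injective, and every morphism `X ⟶ S.X₂` becomes zero in `S.X₃`, then the connecting
homomorphism identifies `X ⟶ S.X₃` with `Ext X S.X₁ 1`. -/
noncomputable def homAddEquivOfInjective (X : 𝒜) {S : ShortComplex 𝒜} (hS : S.ShortExact)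
    [Injective S.X₂] (h : ∀ f : X ⟶ S.X₂, f ≫ S.g = 0) :
    (X ⟶ S.X₃) ≃+ Ext X S.X₁ 1 :=
  addEquiv₀.symm.trans <| AddEquiv.ofBijective (hS.extClass.postcomp X (zero_add 1)) <| by
    constructor
    · rw [injective_iff_map_eq_zero]
      intro x hx
      obtain ⟨y, rfl⟩ := covariant_sequence_exact₃ X hS x (zero_add 1) hx
      rw [← mk₀_addEquiv₀_apply y, mk₀_comp_mk₀, h, mk₀_zero]
    · intro x
      exact covariant_sequence_exact₁ X hS x (eq_zero_of_injective _) (zero_add 1)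

end CategoryTheory.Abelian.Ext

namespace LinearMap

variable {R M N : Type*} [Ring R] [AddCommGroup M] [Module R M] [AddCommGroup N] [Module R N]

/-- The range of a linear map out of a simple module lies in every essential submodule. -/
theorem range_le_of_isSimpleModule_of_essential [IsSimpleModule R M] {E : Submodule R N}
    (hE : ∀ S : Submodule R N, S ≠ ⊥ → S ⊓ E ≠ ⊥) (f : M →ₗ[R] N) : range f ≤ E := by
  by_cases hf : range f = ⊥
  · simp [hf]
  have hcomap : E.comap f ≠ ⊥ := by
    intro h
    apply hE _ hf
    rw [← Submodule.map_comap_eq, h, Submodule.map_bot]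
  rw [range_eq_map, Submodule.map_le_iff_le_comap,
    (eq_bot_or_eq_top (E.comap f)).resolve_left hcomap]

end LinearMap

/-- If `I` is an injective `R`-module, `ι : A → I` an embedding with essential image
(so `I` is an injective hull of the simple module `A`), and `C` a simple `R`-module, then
`Ext¹_R(C, A) ≅ Hom_R(C, I ⧸ range ι)` as abelian groups (`I ⧸ range ι = Ω⁻¹A`). -/
theorem ext_one_iso_hom_cosyzygy (R : Type u) [Ring R]
    (C A I : Type u) [AddCommGroup C] [Module R C] [AddCommGroup A] [Module R A]
    [AddCommGroup I] [Module R I]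
    [IsSimpleModule R A] [IsSimpleModule R C] [Module.Injective R I]
    (ι : A →ₗ[R] I) (hι : Function.Injective ι)
    (hess : ∀ S : Submodule R I, S ≠ ⊥ → S ⊓ LinearMap.range ι ≠ ⊥) :
    Nonempty ((Ext (ModuleCat.of R C) (ModuleCat.of R A) 1) ≃+
      (C →ₗ[R] (I ⧸ LinearMap.range ι))) := by
  let S : ShortComplex (ModuleCat.{u} R) :=
    ShortComplex.mk (ModuleCat.ofHom ι) (ModuleCat.ofHom (LinearMap.range ι).mkQ) <| by
      ext x
      simp
  have hS : S.ShortExact :=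
    { exact := (ShortComplex.ShortExact.moduleCat_exact_iff_function_exact S).mpr
        (LinearMap.exact_map_mkQ_range ι)
      mono_f := (ModuleCat.mono_iff_injective _).mpr hι
      epi_g := (ModuleCat.epi_iff_surjective _).mpr (Submodule.mkQ_surjective _) }
  have : Injective S.X₂ := Module.injective_object_of_injective_module R I
  have hzero (f : ModuleCat.of R C ⟶ S.X₂) : f ≫ S.g = 0 := by
    ext x
    exact (Submodule.Quotient.mk_eq_zero _).mpr <|
      f.hom.range_le_of_isSimpleModule_of_essential hess (LinearMap.mem_range_self f.hom x)
  exact ⟨(Ext.homAddEquivOfInjective (ModuleCat.of R C) hS hzero).symm.trans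
    ModuleCat.homAddEquiv⟩
end

section
/- Let R be a ring and 0 → A → E →σ C → 0 a short exact sequence of R-modules (σ surjective with kernel the image of A, which we identify with ker σ). Assume ker σ and C are simple R-modules, ker σ and C are not isomorphic as R-modules, and the sequence does not split (there is no R-linear s : C → E with σ ∘ s = id_C). Then every R-linear map C → E is zero, i.e. Hom_R(C, E) = 0. -/
/-- Let `0 → A → E →σ C → 0` be a short exact sequence of `R`-modules with `A = ker σ` and
`C` simple and non-isomorphic, which does not split. Then `Hom_R(C, E) = 0`. -/
theorem hom_into_middle_eq_zero (R : Type*) [Ring R]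
    {E C : Type*} [AddCommGroup E] [Module R E] [AddCommGroup C] [Module R C]
    (σ : E →ₗ[R] C) (hσ : Function.Surjective σ)
    (hA : IsSimpleModule R (LinearMap.ker σ)) (hC : IsSimpleModule R C)
    (hni : ¬ Nonempty (↥(LinearMap.ker σ) ≃ₗ[R] C))
    (hns : ¬ ∃ s : C →ₗ[R] E, σ ∘ₗ s = LinearMap.id) :
    ∀ f : C →ₗ[R] E, f = 0 := by
  intro f
  obtain hbij | hzero := (σ ∘ₗ f).bijective_or_eq_zero
  · -- `σ ∘ f` is an automorphism of `C`, so `f` corrected by its inverse splits `σ`.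
    let e := LinearEquiv.ofBijective (σ ∘ₗ f) hbij
    exact (hns ⟨f ∘ₗ e.symm.toLinearMap, LinearMap.ext fun c => e.apply_symm_apply c⟩).elim
  · -- `f` factors through `ker σ`, where Schur's lemma applies.
    let g : C →ₗ[R] LinearMap.ker σ := f.codRestrict _ fun c => LinearMap.congr_fun hzero c
    obtain hbij | hg := g.bijective_or_eq_zero
    · exact (hni ⟨(LinearEquiv.ofBijective g hbij).symm⟩).elim
    · exact LinearMap.ext fun c => congrArg Subtype.val (LinearMap.congr_fun hg c)
end
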